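/- arXiv:1903.10717 — 5 statements merged into one kernel-verified Lean document; each statement's English description precedes it below -/
import Mathlib

section
/- Let N_x, N_w, N_y ≥ 1, G ∈ ℝ^{N_x×N_w}, H ∈ ℝ^{N_y×N_x}, and let R ∈ ℝ^{N_y×N_y} be symmetric positive semidefinite with a symmetric square root R^{1/2} (i.e. R^{1/2}R^{1/2} = R). Set Q = GGᵀ and C = HQHᵀ + R and assume C is invertible. Write A = G(I_{N_w} − GᵀHᵀC⁻¹HG) and B = QHᵀC⁻¹R^{1/2}. Then AAᵀ + BBᵀ = G(I_{N_w} − GᵀHᵀC⁻¹HG)Gᵀ. (This is the algebraic content of the paper's claim that the residual error E^c_t = AW_t − BV_t has covariation ⟨E^c,E^c⟩_t = G(I − GᵀHᵀC⁻¹HG)Gᵀ t.) -/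
open Matrix

/-- Covariation of the residual error `E^c_t = A W_t - B V_t`:
`A Aᵀ + B Bᵀ = G (I - Gᵀ Hᵀ C⁻¹ H G) Gᵀ`. -/
theorem residual_error_covariation
    (Nx Nw Ny : ℕ) (hNx : 1 ≤ Nx) (hNw : 1 ≤ Nw) (hNy : 1 ≤ Ny)
    (G : Matrix (Fin Nx) (Fin Nw) ℝ) (H : Matrix (Fin Ny) (Fin Nx) ℝ)
    (R Rhalf : Matrix (Fin Ny) (Fin Ny) ℝ)
    (hR : R.PosSemidef) (hRhalfSymm : Rhalf.IsSymm) (hRhalf : Rhalf * Rhalf = R)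
    (Q : Matrix (Fin Nx) (Fin Nx) ℝ) (hQ : Q = G * Gᵀ)
    (C : Matrix (Fin Ny) (Fin Ny) ℝ) (hC : C = H * Q * Hᵀ + R)
    (hCinv : IsUnit C.det)
    (A : Matrix (Fin Nx) (Fin Nw) ℝ) (hA : A = G * (1 - Gᵀ * Hᵀ * C⁻¹ * H * G))
    (B : Matrix (Fin Nx) (Fin Ny) ℝ) (hB : B = Q * Hᵀ * C⁻¹ * Rhalf) :
    A * Aᵀ + B * Bᵀ = G * (1 - Gᵀ * Hᵀ * C⁻¹ * H * G) * Gᵀ := by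
  have hRsymm : Rᵀ = R := by
    rw [← hRhalf, transpose_mul, hRhalfSymm.eq]
  have hCsymm : Cᵀ = C := by
    simp [hC, hQ, transpose_mul, Matrix.mul_assoc, hRsymm]
  have hDsymm : (C⁻¹)ᵀ = C⁻¹ := by
    rw [transpose_nonsing_inv, hCsymm]
  have hD : C⁻¹ * (H * Q * Hᵀ + R) * C⁻¹ = C⁻¹ := by
    rw [← hC, nonsing_inv_mul C hCinv, Matrix.one_mul]
  generalize C⁻¹ = D at *
  have hA' : A * Aᵀ = G * Gᵀ - G * Gᵀ * Hᵀ * D * H * G * Gᵀ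
      - G * Gᵀ * Hᵀ * D * H * G * Gᵀ
      + G * Gᵀ * Hᵀ * (D * (H * Q * Hᵀ) * D) * H * G * Gᵀ := by
    simp only [hA, hQ, transpose_mul, transpose_sub, transpose_transpose, hDsymm,
      Matrix.mul_sub, Matrix.sub_mul, Matrix.mul_one, Matrix.mul_assoc]
    abel
  have hB' : B * Bᵀ = G * Gᵀ * Hᵀ * (D * R * D) * H * G * Gᵀ := by
    simp only [hB, hQ, ← hRhalf, transpose_mul, transpose_transpose, hDsymm, hRhalfSymm.eq,
      Matrix.mul_assoc]
  have hsum : G * Gᵀ * Hᵀ * (D * (H * Q * Hᵀ) * D) * H * G * Gᵀ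
      + G * Gᵀ * Hᵀ * (D * R * D) * H * G * Gᵀ = G * Gᵀ * Hᵀ * D * H * G * Gᵀ := by
    simp only [← Matrix.add_mul, ← Matrix.mul_add, hD]
  rw [hA', hB', add_assoc, hsum, sub_add_cancel]
  simp only [Matrix.mul_sub, Matrix.sub_mul, Matrix.mul_one, Matrix.mul_assoc]
end

section
/- Let n, d ≥ 1, let P ∈ ℝ^{n×n} be symmetric positive definite, m ∈ ℝ^n, and let π(x) = ((2π)^n det P)^{−1/2} exp(−(x−m)ᵀP⁻¹(x−m)/2) be the Gaussian density with mean m and covariance P. Let L ∈ ℝ^{d×n}, c ∈ ℝ^d and h(x) = c + Lx. Then (i) ∫ h(x) π(x) dx = c + Lm = h(m), and (ii) the constant matrix field K₀ := PLᵀ ∈ ℝ^{n×d} satisfies, for every k = 1,…,d and every x ∈ ℝ^n, ∑_{i=1}^n ∂_i(π(x) K₀^{ik}) = −π(x)(h^k(x) − h^k(m)). In other words, for Gaussian densities and affine observation maps the Poisson/gain equation of the feedback particle filter is solved exactly by the Kalman-gain matrix PLᵀ. -/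
open Matrix MeasureTheory

/-- A real positive definite matrix factors as `Cᵀ C`. -/
lemma Matrix.PosDef.exists_eq_transpose_mul_self {n : ℕ} {Q : Matrix (Fin n) (Fin n) ℝ}
    (hQ : Q.PosDef) : ∃ C : Matrix (Fin n) (Fin n) ℝ, Q = Cᵀ * C := by
  open scoped MatrixOrder in
  obtain ⟨C, hC⟩ := CStarAlgebra.nonneg_iff_eq_star_mul_self.mp hQ.posSemidef.nonneg
  exact ⟨C, by rw [hC, star_eq_conjTranspose, conjTranspose_eq_transpose_of_trivial]⟩

section ChangeOfVariables

variable {n : ℕ} {C : Matrix (Fin n) (Fin n) ℝ} {f : (Fin n → ℝ) → ℝ}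

lemma integrable_comp_mulVec (hC : C.det ≠ 0) (hf : Integrable f) :
    Integrable fun x => f (C *ᵥ x) := by
  have hmap := Real.map_matrix_volume_pi_eq_smul_volume_pi hC
  have hint : Integrable f (Measure.map (toLin' C) volume) := by
    rw [hmap]
    exact hf.smul_measure ENNReal.ofReal_ne_top
  exact hint.comp_measurable (toLin' C).continuous_of_finiteDimensional.measurable

lemma integral_comp_mulVec (hC : C.det ≠ 0) (hf : Integrable f) :
    ∫ x, f (C *ᵥ x) = |C.det|⁻¹ * ∫ x, f x := by
  have hmap := Real.map_matrix_volume_pi_eq_smul_volume_pi hC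
  have hint : AEStronglyMeasurable f (Measure.map (toLin' C) volume) := by
    rw [hmap]
    exact hf.aestronglyMeasurable.smul_measure _
  have := integral_map
    (toLin' C).continuous_of_finiteDimensional.measurable.aemeasurable hint
  rw [hmap, integral_smul_measure, ENNReal.toReal_ofReal (abs_nonneg _)] at this
  simpa [abs_inv] using this.symm

end ChangeOfVariables

section StandardGaussian

variable {n : ℕ}

lemma exp_neg_dotProduct_self_div_two (y : Fin n → ℝ) :
    Real.exp (-(y ⬝ᵥ y) / 2) = ∏ i, Real.exp (-(1 / 2) * y i ^ 2) := by
  rw [← Real.exp_sum, ← Finset.mul_sum]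
  congr 1
  simp only [dotProduct, pow_two]
  ring

lemma integrable_exp_neg_dotProduct_self_div_two :
    Integrable fun y : Fin n → ℝ => Real.exp (-(y ⬝ᵥ y) / 2) := by
  simp_rw [exp_neg_dotProduct_self_div_two]
  exact Integrable.fintype_prod fun _ => integrable_exp_neg_mul_sq (by norm_num)

lemma integrable_apply_mul_exp_neg_dotProduct_self_div_two (j : Fin n) :
    Integrable fun y : Fin n → ℝ => y j * Real.exp (-(y ⬝ᵥ y) / 2) := by
  have key : (fun y : Fin n → ℝ => y j * Real.exp (-(y ⬝ᵥ y) / 2)) =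
      fun y => ∏ i, (if i = j then y i else 1) * Real.exp (-(1 / 2) * y i ^ 2) := by
    ext y
    rw [exp_neg_dotProduct_self_div_two, Finset.prod_mul_distrib]
    simp
  rw [key]
  refine Integrable.fintype_prod
    (f := fun i (t : ℝ) => (if i = j then t else 1) * Real.exp (-(1 / 2) * t ^ 2)) fun i => ?_
  by_cases hij : i = j
  · simpa [hij] using integrable_mul_exp_neg_mul_sq (b := 1 / 2) (by norm_num)
  · simpa [hij] using integrable_exp_neg_mul_sq (b := 1 / 2) (by norm_num)

lemma integral_exp_neg_dotProduct_self_div_two :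
    ∫ y : Fin n → ℝ, Real.exp (-(y ⬝ᵥ y) / 2) = √((2 * Real.pi) ^ n) := by
  simp_rw [exp_neg_dotProduct_self_div_two]
  rw [integral_fintype_prod_volume_eq_pow (fun t : ℝ => Real.exp (-(1 / 2) * t ^ 2)),
    integral_gaussian, Fintype.card_fin, eq_comm, Real.sqrt_eq_iff_mul_self_eq (by positivity) (by positivity), ← mul_pow,
    Real.mul_self_sqrt (by positivity)]
  ring

end StandardGaussian

section CenteredGaussian

variable {n : ℕ} {P : Matrix (Fin n) (Fin n) ℝ}

lemma Matrix.PosDef.exists_inv_eq_transpose_mul_self (hP : P.PosDef) :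
    ∃ C : Matrix (Fin n) (Fin n) ℝ, C.det ≠ 0 ∧ |C.det|⁻¹ = √P.det ∧
      ∀ z, z ⬝ᵥ (P⁻¹ *ᵥ z) = (C *ᵥ z) ⬝ᵥ (C *ᵥ z) := by
  obtain ⟨C, hC⟩ := hP.inv.exists_eq_transpose_mul_self
  have hdet : P.det⁻¹ = C.det ^ 2 := by
    rw [← Ring.inverse_eq_inv', ← det_nonsing_inv, hC, det_mul, det_transpose, pow_two]
  have hpos : 0 < C.det ^ 2 := hdet ▸ inv_pos.mpr hP.det_pos
  refine ⟨C, by rintro h0; simp [h0] at hpos, ?_, fun z => ?_⟩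
  · rw [← inv_inv P.det, hdet, Real.sqrt_inv, Real.sqrt_sq_eq_abs]
  · rw [hC, ← mulVec_mulVec, mulVec_transpose, dotProduct_comm, ← dotProduct_mulVec]

lemma integrable_exp_neg_quadratic (hP : P.PosDef) :
    Integrable fun z : Fin n → ℝ => Real.exp (-(z ⬝ᵥ (P⁻¹ *ᵥ z)) / 2) := by
  obtain ⟨C, hC, -, hquad⟩ := hP.exists_inv_eq_transpose_mul_self
  simp_rw [hquad]
  exact integrable_comp_mulVec hC integrable_exp_neg_dotProduct_self_div_two

lemma integral_exp_neg_quadratic (hP : P.PosDef) :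
    ∫ z : Fin n → ℝ, Real.exp (-(z ⬝ᵥ (P⁻¹ *ᵥ z)) / 2) = √((2 * Real.pi) ^ n * P.det) := by
  obtain ⟨C, hC, hdet, hquad⟩ := hP.exists_inv_eq_transpose_mul_self
  simp_rw [hquad]
  rw [integral_comp_mulVec hC integrable_exp_neg_dotProduct_self_div_two,
    integral_exp_neg_dotProduct_self_div_two, hdet, Real.sqrt_mul (by positivity), mul_comm]

lemma integrable_dotProduct_mul_exp_neg_quadratic (hP : P.PosDef) (a : Fin n → ℝ) :
    Integrable fun z : Fin n → ℝ => (a ⬝ᵥ z) * Real.exp (-(z ⬝ᵥ (P⁻¹ *ᵥ z)) / 2) := by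
  obtain ⟨C, hC, -, hquad⟩ := hP.exists_inv_eq_transpose_mul_self
  have hinv (z : Fin n → ℝ) : a ⬝ᵥ z = (a ᵥ* C⁻¹) ⬝ᵥ (C *ᵥ z) := by
    rw [← dotProduct_mulVec, mulVec_mulVec, nonsing_inv_mul _ hC.isUnit, one_mulVec]
  simp_rw [hquad, hinv]
  refine integrable_comp_mulVec (f := fun y => ((a ᵥ* C⁻¹) ⬝ᵥ y) * Real.exp (-(y ⬝ᵥ y) / 2)) hC ?_
  simp only [dotProduct.eq_def (a ᵥ* C⁻¹), Finset.sum_mul, mul_assoc]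
  exact integrable_finsetSum _ fun j _ =>
    (integrable_apply_mul_exp_neg_dotProduct_self_div_two j).const_mul _

lemma integral_dotProduct_mul_exp_neg_quadratic (a : Fin n → ℝ) :
    ∫ z : Fin n → ℝ, (a ⬝ᵥ z) * Real.exp (-(z ⬝ᵥ (P⁻¹ *ᵥ z)) / 2) = 0 := by
  have := integral_neg_eq_self
    (fun z : Fin n → ℝ => (a ⬝ᵥ z) * Real.exp (-(z ⬝ᵥ (P⁻¹ *ᵥ z)) / 2)) volume
  simp only [dotProduct_neg, mulVec_neg, neg_dotProduct, neg_neg, neg_mul, integral_neg] at this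
  linarith

lemma hasFDerivAt_exp_neg_quadratic (hP : P.PosDef) (m x : Fin n → ℝ) :
    HasFDerivAt (fun y => Real.exp (-((y - m) ⬝ᵥ (P⁻¹ *ᵥ (y - m))) / 2))
      (-Real.exp (-((x - m) ⬝ᵥ (P⁻¹ *ᵥ (x - m))) / 2) •
        (dotProductBilin ℝ ℝ (P⁻¹ *ᵥ (x - m))).toContinuousLinearMap) x := by
  set B : (Fin n → ℝ) →L[ℝ] (Fin n → ℝ) →L[ℝ] ℝ :=
    LinearMap.toContinuousLinearMap (LinearMap.toContinuousLinearMap.toLinearMap ∘ₗ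
      (dotProductBilin ℝ ℝ : (Fin n → ℝ) →ₗ[ℝ] (Fin n → ℝ) →ₗ[ℝ] ℝ))
  have hsub : HasFDerivAt (fun y => y - m) (ContinuousLinearMap.id ℝ (Fin n → ℝ)) x :=
    (hasFDerivAt_id x).sub_const m
  have hlin : HasFDerivAt (fun y => P⁻¹ *ᵥ (y - m)) _ x :=
    (toLin' P⁻¹).toContinuousLinearMap.hasFDerivAt.comp x hsub
  have hquad : HasFDerivAt (fun y => (y - m) ⬝ᵥ (P⁻¹ *ᵥ (y - m))) _ x :=
    B.hasFDerivAt_of_bilinear hsub hlin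
  simp_rw [div_eq_mul_inv]
  refine (hquad.neg.mul_const (2⁻¹ : ℝ)).exp.congr_fderiv ?_
  ext v
  have hsymm : (x - m) ⬝ᵥ (P⁻¹ *ᵥ v) = (P⁻¹ *ᵥ (x - m)) ⬝ᵥ v := by
    have hinv : P⁻¹ᵀ = P⁻¹ := by
      simpa [conjTranspose_eq_transpose_of_trivial] using hP.inv.isHermitian.eq
    rw [dotProduct_mulVec, ← mulVec_transpose, hinv]
  simp [B, hsymm, dotProduct_comm v, -sub_dotProduct, -map_sub]
  ring

end CenteredGaussian

/-- For a Gaussian density `N(m, P)` and an affine observation map `h(x) = c + Lx`,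
the mean of `h` is `h(m)` and the constant Kalman gain `K₀ = P Lᵀ` solves the
Poisson/gain equation of the feedback particle filter exactly. -/
theorem gaussian_affine_gain_equation
    (n d : ℕ) (hn : 1 ≤ n) (hd : 1 ≤ d)
    (P : Matrix (Fin n) (Fin n) ℝ) (hP : P.PosDef) (hPsymm : P.IsSymm)
    (m : Fin n → ℝ)
    (p : (Fin n → ℝ) → ℝ)
    (hp : p = fun x => ((2 * Real.pi) ^ n * P.det) ^ (-(1 : ℝ) / 2) *
      Real.exp (-((x - m) ⬝ᵥ (P⁻¹ *ᵥ (x - m))) / 2))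
    (L : Matrix (Fin d) (Fin n) ℝ) (c : Fin d → ℝ)
    (h : (Fin n → ℝ) → (Fin d → ℝ)) (hh : h = fun x => c + L *ᵥ x) :
    (∀ k : Fin d, ∫ x, h x k * p x = h m k) ∧
    (∀ (k : Fin d) (x : Fin n → ℝ),
      ∑ i, fderiv ℝ (fun y => p y * (P * Lᵀ) i k) x (Pi.single i 1)
        = -(p x * (h x k - h m k))) := by
  set Z : ℝ := ((2 * Real.pi) ^ n * P.det) ^ (-(1 : ℝ) / 2) with hZ
  have hdiff (k : Fin d) (x : Fin n → ℝ) : h x k = h m k + L k ⬝ᵥ (x - m) := by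
    simp only [hh, Pi.add_apply, mulVec, dotProduct_sub]
    ring
  refine ⟨fun k => ?_, fun k x => ?_⟩
  · have hZmul : Z * √((2 * Real.pi) ^ n * P.det) = 1 := by
      have hpos : 0 < (2 * Real.pi) ^ n * P.det := mul_pos (by positivity) hP.det_pos
      rw [hZ, Real.sqrt_eq_rpow, ← Real.rpow_add hpos]
      norm_num
    calc ∫ x, h x k * p x
        = ∫ z, Z * (h m k * Real.exp (-(z ⬝ᵥ (P⁻¹ *ᵥ z)) / 2) +
            (L k ⬝ᵥ z) * Real.exp (-(z ⬝ᵥ (P⁻¹ *ᵥ z)) / 2)) := by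
          refine .trans (integral_congr_ae (.of_forall fun x => ?_)) (integral_sub_right_eq_self _ m)
          simp only [hp]
          rw [hdiff k x]
          ring
      _ = h m k := by
          rw [integral_const_mul, integral_add ((integrable_exp_neg_quadratic hP).const_mul _)
            (integrable_dotProduct_mul_exp_neg_quadratic hP _), integral_const_mul,
            integral_exp_neg_quadratic hP, integral_dotProduct_mul_exp_neg_quadratic]
          linear_combination h m k * hZmul
  · have hderiv (i : Fin n) : fderiv ℝ (fun y => p y * (P * Lᵀ) i k) x (Pi.single i 1) =
        -p x * ((P⁻¹ *ᵥ (x - m)) i * (P * Lᵀ) i k) := by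
      have hfd := ((hasFDerivAt_exp_neg_quadratic hP m x).const_mul Z).mul_const ((P * Lᵀ) i k)
      rw [hp, hfd.fderiv]
      simp only [_root_.smul_apply, smul_eq_mul, LinearMap.coe_toContinuousLinearMap',
        dotProductBilin_apply_apply, dotProduct_single_one]
      ring
    have hcontract : ∑ i, (P⁻¹ *ᵥ (x - m)) i * (P * Lᵀ) i k = L k ⬝ᵥ (x - m) := by
      change (P⁻¹ *ᵥ (x - m)) ⬝ᵥ (P *ᵥ L k) = _
      rw [dotProduct_mulVec, ← mulVec_transpose, hPsymm.eq, mulVec_mulVec,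
        mul_nonsing_inv _ hP.det_pos.ne'.isUnit, one_mulVec, dotProduct_comm]
    rw [Finset.sum_congr rfl fun i _ => hderiv i, ← Finset.mul_sum, hcontract, hdiff k x]
    ring
end

section
/- Let N_x, N_w, N_y ≥ 1, G ∈ ℝ^{N_x×N_w}, H ∈ ℝ^{N_y×N_x}, R ∈ ℝ^{N_y×N_y} symmetric positive semidefinite, Q = GGᵀ, C = HQHᵀ + R invertible, and F ∈ ℝ^{N_x×N_x}. Let π(x) = ((2π)^{N_x} det P)^{−1/2} exp(−(x−m)ᵀP⁻¹(x−m)/2) be the Gaussian density with mean m ∈ ℝ^{N_x} and symmetric positive definite covariance P, and let h(x) = HFx. Then the constant matrix K := (PFᵀHᵀ + QHᵀ)C⁻¹ solves the correlated-noise gain equation: for every k = 1,…,N_y and every x ∈ ℝ^{N_x}, ∑_{i=1}^{N_x} ∂_i(π(x)(KC − QHᵀ)^{ik}) = −π(x)(h^k(x) − h^k(m)). -/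
open Matrix MeasureTheory

/-- The derivative of a centred quadratic form with symmetric matrix. -/
theorem hasFDerivAt_quadratic {n : Type*} [Fintype n] {A : Matrix n n ℝ}
    (hA : A.IsSymm) (m x : n → ℝ) :
    HasFDerivAt (fun y => (y - m) ⬝ᵥ (A *ᵥ (y - m)))
      ((2 : ℝ) • (dotProductBilin ℝ ℝ (A *ᵥ (x - m))).toContinuousLinearMap) x := by
  have hsub : HasFDerivAt (fun y : n → ℝ => y - m) (ContinuousLinearMap.id ℝ (n → ℝ)) x :=
    (hasFDerivAt_id x).sub_const m
  have hmul := (A.mulVecLin.toContinuousLinearMap.hasFDerivAt (x := x - m)).comp x hsub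
  have hd := HasFDerivAt.fun_sum (u := Finset.univ) fun i _ =>
    ((hasFDerivAt_pi'.mp hsub) i).mul ((hasFDerivAt_pi'.mp hmul) i)
  refine hd.congr_fderiv ?_
  ext v
  have hsymm : (x - m) ⬝ᵥ (A *ᵥ v) = (A *ᵥ (x - m)) ⬝ᵥ v := by
    rw [Matrix.dotProduct_mulVec, ← Matrix.mulVec_transpose, hA.eq]
  have hsum : ∑ i, ((x - m) i * (A *ᵥ v) i + (A *ᵥ (x - m)) i * v i)
      = 2 * ((A *ᵥ (x - m)) ⬝ᵥ v) := by
    rw [Finset.sum_add_distrib, two_mul]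
    exact congrArg (· + _) hsymm
  simpa using hsum

/-- The derivative of an unnormalised Gaussian density with symmetric precision matrix. -/
theorem hasFDerivAt_gaussian {n : Type*} [Fintype n] (c : ℝ) {A : Matrix n n ℝ}
    (hA : A.IsSymm) (m x : n → ℝ) :
    HasFDerivAt (fun y => c * Real.exp (-((y - m) ⬝ᵥ (A *ᵥ (y - m))) / 2))
      (-(c * Real.exp (-((x - m) ⬝ᵥ (A *ᵥ (x - m))) / 2)) •
        (dotProductBilin ℝ ℝ (A *ᵥ (x - m))).toContinuousLinearMap) x := by
  have hd := (((hasFDerivAt_quadratic hA m x).fun_neg.mul_const (2⁻¹ : ℝ)).exp).const_mul c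
  simp only [← div_eq_mul_inv] at hd
  refine hd.congr_fderiv ?_
  ext v
  simp
  ring

/-- For linear dynamics `f(x) = Fx`, a Gaussian density `N(m, P)` and observation map
`h(x) = HFx`, the constant matrix `K = (P Fᵀ Hᵀ + Q Hᵀ) C⁻¹` solves the correlated-noise
gain equation of the feedback particle filter. -/
theorem gaussian_linear_correlated_gain_equation
    (Nx Nw Ny : ℕ) (hNx : 1 ≤ Nx) (hNw : 1 ≤ Nw) (hNy : 1 ≤ Ny)
    (G : Matrix (Fin Nx) (Fin Nw) ℝ) (H : Matrix (Fin Ny) (Fin Nx) ℝ)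
    (R : Matrix (Fin Ny) (Fin Ny) ℝ) (hR : R.PosSemidef)
    (Q : Matrix (Fin Nx) (Fin Nx) ℝ) (hQ : Q = G * Gᵀ)
    (C : Matrix (Fin Ny) (Fin Ny) ℝ) (hC : C = H * Q * Hᵀ + R)
    (hCinv : IsUnit C.det)
    (F : Matrix (Fin Nx) (Fin Nx) ℝ)
    (P : Matrix (Fin Nx) (Fin Nx) ℝ) (hP : P.PosDef) (hPsymm : P.IsSymm)
    (m : Fin Nx → ℝ)
    (p : (Fin Nx → ℝ) → ℝ)
    (hp : p = fun x => ((2 * Real.pi) ^ Nx * P.det) ^ (-(1 : ℝ) / 2) *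
      Real.exp (-((x - m) ⬝ᵥ (P⁻¹ *ᵥ (x - m))) / 2))
    (h : (Fin Nx → ℝ) → (Fin Ny → ℝ)) (hh : h = fun x => (H * F) *ᵥ x)
    (K : Matrix (Fin Nx) (Fin Ny) ℝ) (hK : K = (P * Fᵀ * Hᵀ + Q * Hᵀ) * C⁻¹) :
    ∀ (k : Fin Ny) (x : Fin Nx → ℝ),
      ∑ i, fderiv ℝ (fun y => p y * (K * C - Q * Hᵀ) i k) x (Pi.single i 1)
        = -(p x * (h x k - h m k)) := by
  intro k x
  have hgain : K * C - Q * Hᵀ = P * (H * F)ᵀ := by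
    rw [hK, Matrix.mul_assoc, Matrix.nonsing_inv_mul C hCinv, Matrix.mul_one,
      add_sub_cancel_right, Matrix.transpose_mul, Matrix.mul_assoc]
  have hPdet : IsUnit P.det := (Matrix.isUnit_iff_isUnit_det P).mp hP.isUnit
  have hPinv : P⁻¹.IsSymm := by
    rw [Matrix.IsSymm, Matrix.transpose_nonsing_inv, hPsymm.eq]
  have hderiv (i : Fin Nx) :
      fderiv ℝ (fun y => p y * (K * C - Q * Hᵀ) i k) x (Pi.single i 1)
        = -(p x * ((P⁻¹ *ᵥ (x - m)) i * (P * (H * F)ᵀ) i k)) := by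
    have hd := (hasFDerivAt_gaussian (((2 * Real.pi) ^ Nx * P.det) ^ (-(1 : ℝ) / 2))
      hPinv m x).mul_const ((P * (H * F)ᵀ) i k)
    rw [hgain, hp, hd.fderiv]
    simp
    ring
  have hdot : ∑ i, (P⁻¹ *ᵥ (x - m)) i * (P * (H * F)ᵀ) i k = h x k - h m k := by
    change ((P⁻¹ *ᵥ (x - m)) ᵥ* (P * (H * F)ᵀ)) k = _
    rw [← Matrix.mulVec_transpose, Matrix.transpose_mul, Matrix.transpose_transpose, hPsymm.eq,
      Matrix.mulVec_mulVec, Matrix.mul_assoc, Matrix.mul_nonsing_inv P hPdet, Matrix.mul_one,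
      Matrix.mulVec_sub, hh, Pi.sub_apply]
  rw [Finset.sum_congr rfl fun i _ => hderiv i, Finset.sum_neg_distrib, ← Finset.mul_sum, hdot]
end

section
/- Let N_a, N_x ≥ 1, let Q ∈ ℝ^{N_x×N_x} be symmetric positive definite, B ∈ ℝ^{N_x×N_a}, f₀ ∈ ℝ^{N_x}, and h(a) = f₀ + Ba. Let Π(a) = ((2π)^{N_a} det P^{aa})^{−1/2} exp(−(a−ā)ᵀ(P^{aa})⁻¹(a−ā)/2) be the Gaussian density on ℝ^{N_a} with mean ā and symmetric positive definite covariance P^{aa}. Then the constant Kalman gain matrix K := P^{aa}BᵀQ⁻¹ solves the parameter-estimation gain equation: for every k = 1,…,N_x and every a ∈ ℝ^{N_a}, ∑_{i=1}^{N_a} ∂_i(Π(a)(KQ)^{ik}) = −Π(a)(h^k(a) − h^k(ā)). -/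
open Matrix MeasureTheory

/-- A quadratic form on `ι → ℝ` is differentiable. -/
theorem Matrix.differentiable_dotProduct_mulVec {ι : Type*} [Fintype ι] (A : Matrix ι ι ℝ) :
    Differentiable ℝ fun x : ι → ℝ => x ⬝ᵥ (A *ᵥ x) := by
  simp only [dotProduct, mulVec]
  fun_prop

/-- The directional derivative of a symmetric quadratic form. -/
theorem Matrix.IsSymm.hasLineDerivAt_dotProduct_mulVec {ι : Type*} [Fintype ι]
    {A : Matrix ι ι ℝ} (hA : A.IsSymm) (x v : ι → ℝ) :
    HasLineDerivAt ℝ (fun x : ι → ℝ => x ⬝ᵥ (A *ᵥ x)) (2 * (x ⬝ᵥ (A *ᵥ v))) x v := by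
  have hsymm : v ⬝ᵥ (A *ᵥ x) = x ⬝ᵥ (A *ᵥ v) := by
    rw [dotProduct_mulVec, ← mulVec_transpose, hA.eq, dotProduct_comm]
  have hexp : (fun t : ℝ => (x + t • v) ⬝ᵥ (A *ᵥ (x + t • v))) =
      fun t => x ⬝ᵥ (A *ᵥ x) + t * (2 * (x ⬝ᵥ (A *ᵥ v))) + t ^ 2 * (v ⬝ᵥ (A *ᵥ v)) := by
    funext t
    simp only [mulVec_add, mulVec_smul, add_dotProduct, dotProduct_add, smul_dotProduct,
      dotProduct_smul, smul_eq_mul, hsymm]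
    ring
  unfold HasLineDerivAt
  rw [hexp]
  have := (((hasDerivAt_id (0 : ℝ)).mul_const (2 * (x ⬝ᵥ (A *ᵥ v)))).const_add
    (x ⬝ᵥ (A *ᵥ x))).fun_add (((hasDerivAt_id (0 : ℝ)).fun_pow 2).mul_const (v ⬝ᵥ (A *ᵥ v)))
  simpa using this

theorem differentiable_const_mul_exp_neg_quadratic {ι : Type*} [Fintype ι] (A : Matrix ι ι ℝ)
    (c : ℝ) (m : ι → ℝ) :
    Differentiable ℝ fun y : ι → ℝ => c * Real.exp (-((y - m) ⬝ᵥ (A *ᵥ (y - m))) / 2) := by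
  have hquad : Differentiable ℝ fun y : ι → ℝ => (y - m) ⬝ᵥ (A *ᵥ (y - m)) :=
    A.differentiable_dotProduct_mulVec.comp (differentiable_id.sub_const m)
  simp only [div_eq_mul_inv]
  exact (hquad.fun_neg.mul_const _).exp.const_mul c

/-- The directional derivative of an unnormalized Gaussian density with symmetric precision
matrix `A` and mean `m`. -/
theorem fderiv_const_mul_exp_neg_quadratic {ι : Type*} [Fintype ι] {A : Matrix ι ι ℝ}
    (hA : A.IsSymm) (c : ℝ) (m x v : ι → ℝ) :
    fderiv ℝ (fun y : ι → ℝ => c * Real.exp (-((y - m) ⬝ᵥ (A *ᵥ (y - m))) / 2)) x v =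
      -(c * Real.exp (-((x - m) ⬝ᵥ (A *ᵥ (x - m))) / 2) * ((x - m) ⬝ᵥ (A *ᵥ v))) := by
  rw [← (differentiable_const_mul_exp_neg_quadratic A c m x).lineDeriv_eq_fderiv]
  have hline := hA.hasLineDerivAt_dotProduct_mulVec (x - m) v
  refine HasLineDerivAt.lineDeriv ?_
  unfold HasLineDerivAt at hline ⊢
  have := ((hline.fun_neg.div_const 2).exp).const_mul c
  simp only [zero_smul, add_zero, sub_add_eq_add_sub] at this
  refine this.congr_deriv ?_
  ring

/-- For parameter estimation with drift linear in the parameters, the observation map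
`h(a) = f₀ + Ba` is affine in `a`, and the constant Kalman gain `K = P^{aa} Bᵀ Q⁻¹`
solves the parameter-estimation gain equation exactly for the Gaussian density
`N(ā, P^{aa})`. -/
theorem gaussian_parameter_gain_equation
    (Na Nx : ℕ) (hNa : 1 ≤ Na) (hNx : 1 ≤ Nx)
    (Q : Matrix (Fin Nx) (Fin Nx) ℝ) (hQ : Q.PosDef) (hQsymm : Q.IsSymm)
    (B : Matrix (Fin Nx) (Fin Na) ℝ) (f₀ : Fin Nx → ℝ)
    (h : (Fin Na → ℝ) → (Fin Nx → ℝ)) (hh : h = fun a => f₀ + B *ᵥ a)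
    (Paa : Matrix (Fin Na) (Fin Na) ℝ) (hPaa : Paa.PosDef) (hPaaSymm : Paa.IsSymm)
    (abar : Fin Na → ℝ)
    (p : (Fin Na → ℝ) → ℝ)
    (hp : p = fun a => ((2 * Real.pi) ^ Na * Paa.det) ^ (-(1 : ℝ) / 2) *
      Real.exp (-((a - abar) ⬝ᵥ (Paa⁻¹ *ᵥ (a - abar))) / 2))
    (K : Matrix (Fin Na) (Fin Nx) ℝ) (hK : K = Paa * Bᵀ * Q⁻¹) :
    ∀ (k : Fin Nx) (a : Fin Na → ℝ),
      ∑ i, fderiv ℝ (fun b => p b * (K * Q) i k) a (Pi.single i 1)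
        = -(p a * (h a k - h abar k)) := by
  intro k a
  have hQdet : IsUnit Q.det := hQ.det_pos.ne'.isUnit
  have hPdet : IsUnit Paa.det := hPaa.det_pos.ne'.isUnit
  have hKQ : K * Q = Paa * Bᵀ := by
    rw [hK, Matrix.mul_assoc, nonsing_inv_mul Q hQdet, Matrix.mul_one]
  have hdiff : DifferentiableAt ℝ p a := by
    rw [hp]
    exact differentiable_const_mul_exp_neg_quadratic _ _ _ a
  have hsymm : Paa⁻¹.IsSymm := by
    rw [IsSymm, transpose_nonsing_inv, hPaaSymm.eq]
  have hcol : Paa⁻¹ *ᵥ (K * Q).col k = B k := by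
    rw [hKQ]
    change Paa⁻¹ *ᵥ (Paa *ᵥ Bᵀ.col k) = B k
    rw [mulVec_mulVec, nonsing_inv_mul Paa hPdet, one_mulVec]
    rfl
  have hgrad : fderiv ℝ p a ((K * Q).col k) = -(p a * ((a - abar) ⬝ᵥ B k)) := by
    rw [hp, fderiv_const_mul_exp_neg_quadratic hsymm, hcol]
  calc
    _ = ∑ i, (K * Q).col k i • fderiv ℝ p a (Pi.single i 1) := by
      refine Finset.sum_congr rfl fun i _ => ?_
      rw [fderiv_mul_const hdiff]
      rfl
    _ = fderiv ℝ p a ((K * Q).col k) := by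
      conv_rhs => rw [pi_eq_sum_univ' ((K * Q).col k)]
      simp only [map_sum, map_smul]
    _ = _ := by
      rw [hgrad, hh]
      simp only [Pi.add_apply, add_sub_add_left_eq_sub, mulVec]
      rw [dotProduct_comm, dotProduct_sub]
end

section
/- Let π : ℝ^{N_x} → ℝ be a strictly positive, continuously differentiable probability density such that ∇π is integrable and ∫_{ℝ^{N_x}} ∇π(x) dx = 0. Let f : ℝ^{N_x} → ℝ^{N_x} be measurable with ∫‖f‖ π dx < ∞, let H ∈ ℝ^{N_y×N_x} and Q ∈ ℝ^{N_x×N_x}, and define h(x) = Hf(x) and the modified observation map h̃(x) = H(f(x) − Q∇log π(x)). Then (i) ∫ h̃ π dx = ∫ h π dx, and (ii) for every smooth compactly supported test function φ : ℝ^{N_x} → ℝ: ∫ φ(x)(h̃(x) − π[h̃]) π(x) dx = ∫ [φ(x)(h(x) − π[h]) + HQ∇φ(x)] π(x) dx, where π[g] = ∫ g π dx. Hence the observation-driven gain term of the Kushner–Stratonovich equation for the modified observation map h̃ with uncorrelated noise coincides with the gain term π[φh + HQ∇φ − φπ[h]] of the generalised (correlated-noise) Kushner–Stratonovich equation. -/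
open Matrix MeasureTheory

section IntegrationByParts

variable {E : Type*} [NormedAddCommGroup E] [NormedSpace ℝ E] [MeasurableSpace E] [BorelSpace E]
  {μ : Measure E}

theorem integrable_mul_fderiv_of_hasCompactSupport [IsFiniteMeasureOnCompacts μ]
    {φ p : E → ℝ} (hφ : Continuous φ) (hφc : HasCompactSupport φ) (hp : ContDiff ℝ 1 p) (v : E) :
    Integrable (fun x => φ x * fderiv ℝ p x v) μ :=
  (hφ.mul ((hp.continuous_fderiv one_ne_zero).clm_apply continuous_const)
    ).integrable_of_hasCompactSupport hφc.mul_right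

theorem integrable_fderiv_mul_of_hasCompactSupport [IsFiniteMeasureOnCompacts μ]
    {φ p : E → ℝ} (hφ : ContDiff ℝ 1 φ) (hφc : HasCompactSupport φ) (hp : Continuous p) (v : E) :
    Integrable (fun x => fderiv ℝ φ x v * p x) μ :=
  (((hφ.continuous_fderiv one_ne_zero).clm_apply continuous_const).mul hp
    ).integrable_of_hasCompactSupport (hφc.fderiv_apply (𝕜 := ℝ) v).mul_right

theorem integral_mul_fderiv_eq_neg_of_hasCompactSupport [FiniteDimensional ℝ E]
    [μ.IsAddHaarMeasure] {φ p : E → ℝ} (hφ : ContDiff ℝ 1 φ) (hφc : HasCompactSupport φ)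
    (hp : ContDiff ℝ 1 p) (v : E) :
    ∫ x, φ x * fderiv ℝ p x v ∂μ = -∫ x, fderiv ℝ φ x v * p x ∂μ :=
  integral_mul_fderiv_eq_neg_fderiv_mul_of_integrable
    (integrable_fderiv_mul_of_hasCompactSupport hφ hφc hp.continuous v)
    (integrable_mul_fderiv_of_hasCompactSupport hφ.continuous hφc hp v)
    ((hφ.continuous.mul hp.continuous).integrable_of_hasCompactSupport hφc.mul_right)
    (fun x _ => hφ.differentiable one_ne_zero x) (fun x _ => hp.differentiable one_ne_zero x)

end IntegrationByParts

theorem integrable_mulVec_mul_of_integrable_norm_mul {α m n : Type*} [MeasurableSpace α]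
    {μ : Measure α} [Fintype n] {f : α → n → ℝ} {p : α → ℝ} (hf : AEStronglyMeasurable f μ)
    (hp : AEStronglyMeasurable p μ) (hfp : Integrable (fun x => ‖f x‖ * p x) μ)
    (H : Matrix m n ℝ) (k : m) : Integrable (fun x => (H *ᵥ f x) k * p x) μ := by
  have hcoord (i : n) : Integrable (fun x => f x i * p x) μ := by
    refine hfp.mono
      (((continuous_apply i).comp_aestronglyMeasurable hf).mul hp) (.of_forall fun x => ?_)
    simpa only [norm_mul, norm_norm] using
      mul_le_mul_of_nonneg_right (norm_le_pi_norm (f x) i) (norm_nonneg (p x))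
  simp only [mulVec, dotProduct, Finset.sum_mul, mul_assoc]
  exact integrable_finsetSum _ fun i _ => (hcoord i).const_mul _

theorem mulVec_sub_mulVec_div_apply_mul {m n : Type*} [Fintype n] (H : Matrix m n ℝ)
    (Q : Matrix n n ℝ) (u g : n → ℝ) {c : ℝ} (hc : c ≠ 0) (k : m) :
    (H *ᵥ (u - Q *ᵥ fun i => g i / c)) k * c
      = (H *ᵥ u) k * c - ∑ j, (H * Q) k j * g j := by
  rw [mulVec_sub, mulVec_mulVec, Pi.sub_apply, sub_mul]
  congr 1
  simp only [mulVec, dotProduct, Finset.sum_mul]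
  exact Finset.sum_congr rfl fun j _ => by rw [mul_assoc, div_mul_cancel₀ _ hc]

/-- The modified observation map `h̃(x) = H(f(x) - Q ∇log π(x))` has the same mean under
`π` as `h(x) = Hf(x)`, and its Kushner–Stratonovich gain term coincides with the gain
term `π[φh + HQ∇φ - φπ[h]]` of the generalised (correlated-noise) Kushner–Stratonovich
equation. -/
theorem modified_observation_map_gain_term
    (Nx Ny : ℕ)
    (p : (Fin Nx → ℝ) → ℝ) (hppos : ∀ x, 0 < p x) (hp : ContDiff ℝ 1 p)
    (hpint : ∫ x, p x = 1)
    (hgradint : ∀ i, Integrable (fun x => fderiv ℝ p x (Pi.single i 1)))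
    (hgradzero : ∀ i, ∫ x, fderiv ℝ p x (Pi.single i 1) = 0)
    (f : (Fin Nx → ℝ) → (Fin Nx → ℝ)) (hfmeas : Measurable f)
    (hfint : Integrable (fun x => ‖f x‖ * p x))
    (H : Matrix (Fin Ny) (Fin Nx) ℝ) (Q : Matrix (Fin Nx) (Fin Nx) ℝ)
    (h htilde : (Fin Nx → ℝ) → (Fin Ny → ℝ))
    (hh : h = fun x => H *ᵥ f x)
    (hht : htilde = fun x =>
      H *ᵥ (f x - Q *ᵥ fun i => fderiv ℝ p x (Pi.single i 1) / p x)) :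
    (∀ k : Fin Ny, ∫ x, htilde x k * p x = ∫ x, h x k * p x) ∧
    (∀ (φ : (Fin Nx → ℝ) → ℝ), ContDiff ℝ (⊤ : ℕ∞) φ → HasCompactSupport φ →
      ∀ k : Fin Ny,
        ∫ x, φ x * (htilde x k - ∫ y, htilde y k * p y) * p x
          = ∫ x, (φ x * (h x k - ∫ y, h y k * p y)
              + ((H * Q) *ᵥ fun i => fderiv ℝ φ x (Pi.single i 1)) k) * p x) := by
  have hpI : Integrable p := .of_integral_ne_zero (by rw [hpint]; exact one_ne_zero)
  have hhI (k : Fin Ny) : Integrable (fun x => h x k * p x) := by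
    subst hh
    exact integrable_mulVec_mul_of_integrable_norm_mul hfmeas.aestronglyMeasurable
      hpI.aestronglyMeasurable hfint H k
  have hpt (x : Fin Nx → ℝ) (k : Fin Ny) : htilde x k * p x
      = h x k * p x - ∑ j, (H * Q) k j * fderiv ℝ p x (Pi.single j 1) := by
    subst hh hht
    exact mulVec_sub_mulVec_div_apply_mul H Q _ _ (hppos x).ne' k
  have hmean (k : Fin Ny) : ∫ x, htilde x k * p x = ∫ x, h x k * p x := by
    simp_rw [hpt]
    rw [integral_sub (hhI k) (integrable_finsetSum _ fun j _ => (hgradint j).const_mul _),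
      integral_finsetSum _ fun j _ => (hgradint j).const_mul _]
    simp [integral_const_mul, hgradzero]
  refine ⟨hmean, fun φ hφ hφc k => ?_⟩
  rw [hmean k]
  set c := ∫ y, h y k * p y
  have hφ1 : ContDiff ℝ 1 φ := hφ.of_le (by exact_mod_cast le_top)
  obtain ⟨C, hC⟩ := hφc.exists_bound_of_continuous hφ.continuous
  have hgain : Integrable (fun x => φ x * (h x k * p x - c * p x)) :=
    ((hhI k).sub (hpI.const_mul c)).bdd_mul hφ.continuous.aestronglyMeasurable (.of_forall hC)
  have hφp (j : Fin Nx) :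
      Integrable (fun x => (H * Q) k j * (φ x * fderiv ℝ p x (Pi.single j 1))) :=
    (integrable_mul_fderiv_of_hasCompactSupport hφ.continuous hφc hp _).const_mul _
  have hpφ (j : Fin Nx) :
      Integrable (fun x => (H * Q) k j * (fderiv ℝ φ x (Pi.single j 1) * p x)) :=
    (integrable_fderiv_mul_of_hasCompactSupport hφ1 hφc hp.continuous _).const_mul _
  have hleft (x : Fin Nx → ℝ) : φ x * (htilde x k - c) * p x
      = φ x * (h x k * p x - c * p x)
        - ∑ j, (H * Q) k j * (φ x * fderiv ℝ p x (Pi.single j 1)) := by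
    simp only [mul_left_comm _ (φ x), ← Finset.mul_sum]
    linear_combination φ x * hpt x k
  have hright (x : Fin Nx → ℝ) : (φ x * (h x k - c)
        + ((H * Q) *ᵥ fun i => fderiv ℝ φ x (Pi.single i 1)) k) * p x
      = φ x * (h x k * p x - c * p x)
        + ∑ j, (H * Q) k j * (fderiv ℝ φ x (Pi.single j 1) * p x) := by
    simp only [mulVec, dotProduct, ← mul_assoc, ← Finset.sum_mul]
    ring
  simp_rw [hleft, hright]
  rw [integral_sub hgain (integrable_finsetSum _ fun j _ => hφp j),
    integral_add hgain (integrable_finsetSum _ fun j _ => hpφ j),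
    integral_finsetSum _ fun j _ => hφp j, integral_finsetSum _ fun j _ => hpφ j,
    sub_eq_add_neg, ← Finset.sum_neg_distrib]
  simp only [integral_const_mul, integral_mul_fderiv_eq_neg_of_hasCompactSupport hφ1 hφc hp,
    mul_neg, neg_neg]
end
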